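/- arXiv:2404.13021 — 4 statements merged into one kernel-verified Lean document; each statement's English description precedes it below -/
import Mathlib

section
/- Let (A_k)_{k≥0} be a sequence of nonnegative real numbers and let ρ, β ∈ (0,1). Then for every integer K ≥ 1, ∑_{k=0}^{K−1} A_k ∑_{i=0}^{k} ρ^{k−i} ∑_{j=0}^{i−1} β^{i−j} A_j ≤ (β/((1−β)(1−ρ))) ∑_{k=0}^{K−1} A_k². -/
/-- Energy estimate for a stable scalar linear recursion started at zero. -/
theorem sum_sq_le_of_linear_recursion {x y : ℕ → ℝ} {r : ℝ} (hr0 : 0 ≤ r) (hr1 : r < 1)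
    (hx0 : x 0 = 0) (hx : ∀ n, x (n + 1) = r * x n + y n) (n : ℕ) :
    (1 - r) ^ 2 * ∑ k ∈ Finset.range (n + 1), x k ^ 2 ≤ ∑ k ∈ Finset.range n, y k ^ 2 := by
  have key : (1 - r) ^ 2 * ∑ k ∈ Finset.range n, x k ^ 2 + (1 - r) * x n ^ 2
      ≤ ∑ k ∈ Finset.range n, y k ^ 2 := by
    induction n with
    | zero => simp [hx0]
    | succ n ih =>
      rw [Finset.sum_range_succ, Finset.sum_range_succ, hx]
      nlinarith [mul_nonneg hr0 (sq_nonneg ((1 - r) * x n - y n))]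
  rw [Finset.sum_range_succ]
  nlinarith [mul_nonneg (mul_nonneg hr0 (sub_nonneg.2 hr1.le)) (sq_nonneg (x n))]

theorem sum_range_succ_pow_sub_mul (r : ℝ) (y : ℕ → ℝ) (n : ℕ) :
    ∑ i ∈ Finset.range (n + 1), r ^ (n + 1 - i) * y i
      = r * ∑ i ∈ Finset.range (n + 1), r ^ (n - i) * y i := by
  rw [Finset.mul_sum]
  refine Finset.sum_congr rfl fun i hi => ?_
  rw [Nat.succ_sub (Finset.mem_range_succ_iff.1 hi), pow_succ]
  ring

/-- Young's convolution inequality for a truncated geometric kernel. -/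
theorem sum_sq_geom_conv_le (y : ℕ → ℝ) {r : ℝ} (hr0 : 0 ≤ r) (hr1 : r < 1) (n : ℕ) :
    (1 - r) ^ 2 * ∑ k ∈ Finset.range n, (∑ i ∈ Finset.range (k + 1), r ^ (k - i) * y i) ^ 2
      ≤ ∑ k ∈ Finset.range n, y k ^ 2 := by
  have h := sum_sq_le_of_linear_recursion (y := y)
    (x := fun n => ∑ i ∈ Finset.range n, r ^ (n - 1 - i) * y i) hr0 hr1 (by simp) (fun n => by
      cases n with
      | zero => simp
      | succ n =>
        simp only [Nat.add_sub_cancel]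
        rw [Finset.sum_range_succ, sum_range_succ_pow_sub_mul]
        simp) n
  rw [Finset.sum_range_succ'] at h
  simpa using h

/-- Young's convolution inequality for a truncated geometric kernel without its diagonal term. -/
theorem sum_sq_strict_geom_conv_le (y : ℕ → ℝ) {r : ℝ} (hr0 : 0 ≤ r) (hr1 : r < 1) (n : ℕ) :
    (1 - r) ^ 2 * ∑ k ∈ Finset.range n, (∑ i ∈ Finset.range k, r ^ (k - i) * y i) ^ 2
      ≤ r ^ 2 * ∑ k ∈ Finset.range n, y k ^ 2 := by
  have h := sum_sq_le_of_linear_recursion (y := fun i => r * y i)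
    (x := fun n => ∑ i ∈ Finset.range n, r ^ (n - i) * y i) hr0 hr1 (by simp) (fun n => by
      rw [sum_range_succ_pow_sub_mul, Finset.sum_range_succ]
      simp [mul_add]) n
  simp only [mul_pow, ← Finset.mul_sum] at h
  refine le_trans ?_ h
  rw [Finset.sum_range_succ]
  gcongr
  exact le_add_of_nonneg_right (sq_nonneg _)

/-- Lemma A.1(c): for a nonnegative sequence `A` and `ρ, β ∈ (0,1)`,
`∑_{k=0}^{K−1} A_k ∑_{i=0}^{k} ρ^{k−i} ∑_{j=0}^{i−1} β^{i−j} A_j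
  ≤ (β/((1−β)(1−ρ))) ∑_{k=0}^{K−1} A_k²`. -/
theorem sum_mul_double_geom_weighted_le (A : ℕ → ℝ) (hA : ∀ k, 0 ≤ A k)
    (ρ : ℝ) (hρ0 : 0 < ρ) (hρ1 : ρ < 1)
    (β : ℝ) (hβ0 : 0 < β) (hβ1 : β < 1) (K : ℕ) (hK : 1 ≤ K) :
    ∑ k ∈ Finset.range K,
        A k * ∑ i ∈ Finset.range (k + 1),
            ρ ^ (k - i) * ∑ j ∈ Finset.range i, β ^ (i - j) * A j
      ≤ (β / ((1 - β) * (1 - ρ))) * ∑ k ∈ Finset.range K, (A k) ^ 2 := by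
  set B : ℕ → ℝ := fun i => ∑ j ∈ Finset.range i, β ^ (i - j) * A j
  set C : ℕ → ℝ := fun k => ∑ i ∈ Finset.range (k + 1), ρ ^ (k - i) * B i
  have hB : (1 - β) ^ 2 * ∑ k ∈ Finset.range K, B k ^ 2
      ≤ β ^ 2 * ∑ k ∈ Finset.range K, A k ^ 2 := sum_sq_strict_geom_conv_le A hβ0.le hβ1 K
  have hC : (1 - ρ) ^ 2 * ∑ k ∈ Finset.range K, C k ^ 2
      ≤ ∑ k ∈ Finset.range K, B k ^ 2 := sum_sq_geom_conv_le B hρ0.le hρ1 K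
  have hβ : 0 < 1 - β := sub_pos.2 hβ1
  have hρ : 0 < 1 - ρ := sub_pos.2 hρ1
  have hCA : ∑ k ∈ Finset.range K, C k ^ 2
      ≤ (β / ((1 - β) * (1 - ρ))) ^ 2 * ∑ k ∈ Finset.range K, A k ^ 2 := by
    rw [div_pow, div_mul_eq_mul_div, le_div_iff₀ (by positivity)]
    nlinarith [mul_le_mul_of_nonneg_left hC (sq_nonneg (1 - β))]
  have hcs := Finset.sum_mul_sq_le_sq_mul_sq (Finset.range K) A C
  have hS : 0 ≤ ∑ k ∈ Finset.range K, A k ^ 2 := Finset.sum_nonneg fun k _ => sq_nonneg _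
  refine le_of_sq_le_sq (hcs.trans ?_) (by positivity)
  calc _ ≤ _ := mul_le_mul_of_nonneg_left hCA hS
    _ = _ := by ring
end

section
/- For all x, x̄ ∈ X and y, ȳ ∈ Y, ‖v(x,y) − v(x̄,ȳ)‖ ≤ C_{v1} ‖x − x̄‖ + C_{v2} ‖y − ȳ‖, where C_{v1} := (L^Φ_{θx} + L^Φ_{θθ} L_θ)/μ_g + (C^Φ_θ L^g_{θθ}/μ_g²)(1 + L_θ) and C_{v2} := L^Φ_{θy}/μ_g. -/
open scoped RealInnerProductSpace

abbrev En (k : ℕ) : Type := EuclideanSpace ℝ (Fin k)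

section StrongConvexity

variable {E : Type*} [NormedAddCommGroup E] [InnerProductSpace ℝ E]

theorem StrongConvexOn.inner_gradient_add_le [CompleteSpace E] {f : E → ℝ} {f' x y : E} {μ : ℝ}
    (hf : StrongConvexOn Set.univ μ f) (hf' : HasGradientAt f f' x) :
    f x + ⟪f', y - x⟫ + μ / 2 * ‖y - x‖ ^ 2 ≤ f y := by
  have hslope := (hf'.hasFDerivAt.hasLineDerivAt (y - x)).tendsto_slope_zero_right
  simp only [InnerProductSpace.toDual_apply_apply, smul_eq_mul] at hslope
  have hbound : Filter.Tendsto (fun t : ℝ => f y - f x - (1 - t) * (μ / 2 * ‖y - x‖ ^ 2))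
      (nhdsWithin 0 (Set.Ioi 0)) (nhds (f y - f x - (1 - 0) * (μ / 2 * ‖y - x‖ ^ 2))) :=
    tendsto_nhdsWithin_of_tendsto_nhds
      (Continuous.tendsto (by fun_prop) 0)
  have hle := le_of_tendsto_of_tendsto hslope hbound <| by
    filter_upwards [Ioo_mem_nhdsGT (zero_lt_one (α := ℝ))] with t ht
    have hconv := hf.2 (Set.mem_univ x) (Set.mem_univ y) (sub_nonneg.2 ht.2.le) ht.1.le
      (sub_add_cancel 1 t)
    have hpt : (1 - t) • x + t • y = x + t • (y - x) := by module
    rw [hpt, norm_sub_rev x y] at hconv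
    simp only [smul_eq_mul] at hconv
    rw [inv_mul_le_iff₀ ht.1]
    linarith
  linarith

theorem StrongConvexOn.inner_gradient_sub_ge [CompleteSpace E] {f : E → ℝ} {f' : E → E} {μ : ℝ}
    (hf : StrongConvexOn Set.univ μ f) (hf' : ∀ x, HasGradientAt f (f' x) x) (x y : E) :
    μ * ‖x - y‖ ^ 2 ≤ ⟪f' x - f' y, x - y⟫ := by
  have hxy := hf.inner_gradient_add_le (y := y) (hf' x)
  have hyx := hf.inner_gradient_add_le (y := x) (hf' y)
  rw [← neg_sub x y, inner_neg_right, norm_neg] at hxy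
  rw [inner_sub_left]
  linarith

theorem inner_fderiv_ge_of_strongly_monotone {F : E → E} {F' : E →L[ℝ] E} {x : E} {μ : ℝ}
    (hF : ∀ x y, μ * ‖x - y‖ ^ 2 ≤ ⟪F x - F y, x - y⟫) (hF' : HasFDerivAt F F' x) (w : E) :
    μ * ‖w‖ ^ 2 ≤ ⟪F' w, w⟫ := by
  have hslope := (hF'.hasLineDerivAt w).tendsto_slope_zero_right
  refine ge_of_tendsto (hslope.inner (tendsto_const_nhds (x := w))) ?_
  filter_upwards [self_mem_nhdsWithin] with t (ht : 0 < t)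
  have hmono := hF (x + t • w) x
  rw [add_sub_cancel_left, norm_smul, inner_smul_right, Real.norm_of_nonneg ht.le] at hmono
  rw [real_inner_smul_left, le_inv_mul_iff₀ ht]
  nlinarith

theorem mul_norm_le_of_mul_norm_sq_le_inner {u w : E} {μ : ℝ} (h : μ * ‖w‖ ^ 2 ≤ ⟪u, w⟫) :
    μ * ‖w‖ ≤ ‖u‖ := by
  rcases (norm_nonneg w).eq_or_lt with hw | hw
  · simp [← hw]
  · refine le_of_mul_le_mul_right ?_ hw
    linarith [real_inner_le_norm u w]

end StrongConvexity

/-- Lemma 1: Lipschitz continuity of the map `v(x,y) = [∇²_{θθ}g(x,θ*(x))]⁻¹ ∇_θΦ(x,θ*(x),y)`. -/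
theorem v_lipschitz {n m d : ℕ}
    -- Assumption 4: `X` and `Y` are nonempty convex compact sets
    (X : Set (En n)) (Y : Set (En d))
    (hXne : X.Nonempty) (hXconv : Convex ℝ X) (hXcomp : IsCompact X)
    (hYne : Y.Nonempty) (hYconv : Convex ℝ Y) (hYcomp : IsCompact Y)
    -- Assumption 1: `Φ` is continuously differentiable, concave in `y`, with
    -- Lipschitz partial gradients
    (Φ : En n → En m → En d → ℝ)
    (gradxΦ : En n → En m → En d → En n)
    (gradθΦ : En n → En m → En d → En m)
    (gradyΦ : En n → En m → En d → En d)
    (hΦsmooth : ContDiff ℝ 1 (fun p : En n × En m × En d => Φ p.1 p.2.1 p.2.2))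
    (hgradx : ∀ x θ y, HasGradientAt (fun x' => Φ x' θ y) (gradxΦ x θ y) x)
    (hgradθ : ∀ x θ y, HasGradientAt (fun θ' => Φ x θ' y) (gradθΦ x θ y) θ)
    (hgrady : ∀ x θ y, HasGradientAt (fun y' => Φ x θ y') (gradyΦ x θ y) y)
    (hconc : ∀ x θ, ConcaveOn ℝ Set.univ (Φ x θ))
    (Lxx Lxθ Lxy Lθx Lθθ Lθy Lyx Lyθ Lyy : ℝ)
    (hLxx : 0 ≤ Lxx) (hLxθ : 0 ≤ Lxθ) (hLxy : 0 ≤ Lxy)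
    (hLθx : 0 ≤ Lθx) (hLθθ : 0 ≤ Lθθ) (hLθy : 0 ≤ Lθy)
    (hLyx : 0 ≤ Lyx) (hLyθ : 0 ≤ Lyθ) (hLyy : 0 ≤ Lyy)
    (hLipxΦ : ∀ x x' θ θ' y y',
      ‖gradxΦ x θ y - gradxΦ x' θ' y'‖ ≤ Lxx * ‖x - x'‖ + Lxθ * ‖θ - θ'‖ + Lxy * ‖y - y'‖)
    (hLipθΦ : ∀ x x' θ θ' y y',
      ‖gradθΦ x θ y - gradθΦ x' θ' y'‖ ≤ Lθx * ‖x - x'‖ + Lθθ * ‖θ - θ'‖ + Lθy * ‖y - y'‖)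
    (hLipyΦ : ∀ x x' θ θ' y y',
      ‖gradyΦ x θ y - gradyΦ x' θ' y'‖ ≤ Lyx * ‖x - x'‖ + Lyθ * ‖θ - θ'‖ + Lyy * ‖y - y'‖)
    -- Assumption 2: the lower-level objective `g`
    (g : En n → En m → ℝ) (gθ : En n → En m → En m)
    (μg Lg Cgθx Lgθx Lgθθ : ℝ)
    (hμg : 0 < μg) (hLg : 0 ≤ Lg) (hCgθx : 0 ≤ Cgθx) (hLgθx : 0 ≤ Lgθx) (hLgθθ : 0 ≤ Lgθθ)
    (hg2 : ∀ x ∈ X, ContDiff ℝ 2 (g x))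
    (hgsc : ∀ x ∈ X, StrongConvexOn Set.univ μg (g x))
    (hggrad : ∀ x ∈ X, ∀ θ, HasGradientAt (g x) (gθ x θ) θ)
    (hgθLipθ : ∀ x ∈ X, ∀ θ θ', ‖gθ x θ - gθ x θ'‖ ≤ Lg * ‖θ - θ'‖)
    (hgθLipx : ∀ θ, ∀ x ∈ X, ∀ x' ∈ X, ‖gθ x θ - gθ x' θ‖ ≤ Cgθx * ‖x - x'‖)
    -- second derivatives `∇²_{θθ} g` and `∇²_{θx} g` and their Lipschitz continuity
    (Hθθ : En n → En m → (En m →L[ℝ] En m))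
    (Gθx : En n → En m → (En m →L[ℝ] En n))
    (hHθθ : ∀ x ∈ X, ∀ θ, HasFDerivAt (gθ x) (Hθθ x θ) θ)
    (hGθx : ∀ θ, ∀ x ∈ X,
      HasFDerivAt (fun x' => gθ x' θ) (ContinuousLinearMap.adjoint (Gθx x θ)) x)
    (hHθθLip : ∀ x ∈ X, ∀ x' ∈ X, ∀ θ θ',
      ‖Hθθ x θ - Hθθ x' θ'‖ ≤ Lgθθ * (‖x - x'‖ + ‖θ - θ'‖))
    (hGθxLip : ∀ x ∈ X, ∀ x' ∈ X, ∀ θ θ',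
      ‖Gθx x θ - Gθx x' θ'‖ ≤ Lgθx * (‖x - x'‖ + ‖θ - θ'‖))
    -- `θ*(x)` is the minimizer of `g(x,·)`
    (θstar : En n → En m)
    (hθmin : ∀ x ∈ X, IsMinOn (g x) Set.univ (θstar x))
    (hθgrad : ∀ x ∈ X, gθ x (θstar x) = 0)
    -- Assumption 3
    (CΦθ : ℝ) (hCΦθ0 : 0 ≤ CΦθ)
    (hCΦθ : ∀ x ∈ X, ∀ y ∈ Y, ‖gradθΦ x (θstar x) y‖ ≤ CΦθ)
    -- `v(x,y) = [∇²_{θθ} g(x,θ*(x))]⁻¹ ∇_θΦ(x,θ*(x),y)`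
    (v : En n → En d → En m)
    (hv : ∀ x ∈ X, ∀ y, Hθθ x (θstar x) (v x y) = gradθΦ x (θstar x) y)
    (Lθ Cv1 Cv2 : ℝ)
    (hLθ : Lθ = Cgθx / μg)
    (hCv1 : Cv1 = (Lθx + Lθθ * Lθ) / μg + CΦθ * Lgθθ / μg ^ 2 * (1 + Lθ))
    (hCv2 : Cv2 = Lθy / μg) :
    ∀ x ∈ X, ∀ x' ∈ X, ∀ y ∈ Y, ∀ y' ∈ Y,
      ‖v x y - v x' y'‖ ≤ Cv1 * ‖x - x'‖ + Cv2 * ‖y - y'‖ := by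
  intro x hx x' hx' y hy y' hy'
  have hmono : ∀ z ∈ X, ∀ θ θ', μg * ‖θ - θ'‖ ^ 2 ≤ ⟪gθ z θ - gθ z θ', θ - θ'⟫ := fun z hz =>
    (hgsc z hz).inner_gradient_sub_ge (hggrad z hz)
  have hcoer : ∀ z ∈ X, ∀ θ w, μg * ‖w‖ ≤ ‖Hθθ z θ w‖ := fun z hz θ w =>
    mul_norm_le_of_mul_norm_sq_le_inner
      (inner_fderiv_ge_of_strongly_monotone (hmono z hz) (hHθθ z hz θ) w)
  have hθ : ‖θstar x - θstar x'‖ ≤ Lθ * ‖x - x'‖ := by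
    have h := mul_norm_le_of_mul_norm_sq_le_inner (hmono x hx (θstar x) (θstar x'))
    rw [hθgrad x hx, ← hθgrad x' hx', norm_sub_rev (gθ _ _)] at h
    rw [hLθ, div_mul_eq_mul_div, le_div_iff₀' hμg]
    exact h.trans (hgθLipx _ x hx x' hx')
  have hv' : ‖v x' y'‖ ≤ CΦθ / μg := by
    rw [le_div_iff₀' hμg]
    refine (hcoer x' hx' (θstar x') _).trans ?_
    rw [hv x' hx']
    exact hCΦθ x' hx' y' hy'
  have hgrad : ‖gradθΦ x (θstar x) y - gradθΦ x' (θstar x') y'‖ ≤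
      Lθx * ‖x - x'‖ + Lθθ * (Lθ * ‖x - x'‖) + Lθy * ‖y - y'‖ :=
    (hLipθΦ _ _ _ _ _ _).trans (by gcongr)
  have hHess : ‖(Hθθ x (θstar x) - Hθθ x' (θstar x')) (v x' y')‖ ≤
      Lgθθ * (‖x - x'‖ + Lθ * ‖x - x'‖) * (CΦθ / μg) := by
    refine ContinuousLinearMap.le_of_opNorm_le_of_le _ ?_ hv'
    exact (hHθθLip x hx x' hx' _ _).trans (by gcongr)
  have hsplit : Hθθ x (θstar x) (v x y - v x' y') =
      (gradθΦ x (θstar x) y - gradθΦ x' (θstar x') y') -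
        (Hθθ x (θstar x) - Hθθ x' (θstar x')) (v x' y') := by
    rw [map_sub, sub_apply, hv x hx, hv x' hx']
    abel
  have hmain := hcoer x hx (θstar x) (v x y - v x' y')
  rw [hsplit] at hmain
  replace hmain := hmain.trans (norm_sub_le _ _)
  have hbound : ‖v x y - v x' y'‖ ≤ (Lθx * ‖x - x'‖ + Lθθ * (Lθ * ‖x - x'‖) + Lθy * ‖y - y'‖ +
      Lgθθ * (‖x - x'‖ + Lθ * ‖x - x'‖) * (CΦθ / μg)) / μg := by
    rw [le_div_iff₀' hμg]
    linarith
  refine hbound.trans_eq ?_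
  rw [hCv1, hCv2]
  field_simp
  ring
end

section
/- Let μ > 0 and y_0 ∈ Y, and for each x ∈ X let y*_μ(x) be the unique maximizer over y ∈ Y of L(x,y) − (μ/2)‖y − y_0‖². Then for all x, x̄ ∈ X, ‖y*_μ(x) − y*_μ(x̄)‖ ≤ (L_{yμ}/μ) ‖x − x̄‖, where L_{yμ} := L^Φ_{yx} + L_θ L^Φ_{yθ} and L_θ := C^g_{θx}/μ_g. -/
open scoped RealInnerProductSpace

section GradientInequalities

variable {E : Type*} [NormedAddCommGroup E] [InnerProductSpace ℝ E]

theorem norm_le_div_of_mul_norm_sq_le_inner {v w : E} {c K : ℝ} (hc : 0 < c)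
    (h : c * ‖w‖ ^ 2 ≤ ⟪v, w⟫) (hv : ‖v‖ ≤ K) : ‖w‖ ≤ K / c := by
  rw [le_div_iff₀ hc]
  rcases (norm_nonneg w).eq_or_lt with hw | hw
  · rw [← hw, zero_mul]
    exact (norm_nonneg v).trans hv
  · have h1 := h.trans ((real_inner_le_norm v w).trans (mul_le_mul_of_nonneg_right hv hw.le))
    refine le_of_mul_le_mul_right ?_ hw
    linarith

variable [CompleteSpace E]

/-- A linear upper bound on the increments of `f` along a segment bounds the directional
derivative at the starting point. -/
theorem HasGradientAt.inner_le_of_segment_le {f : E → ℝ} {v a b : E} {c : ℝ}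
    (hf : HasGradientAt f v a)
    (h : ∀ t : ℝ, 0 < t → t < 1 → f (a + t • (b - a)) - f a ≤ t * c) :
    ⟪v, b - a⟫ ≤ c := by
  have hline : HasDerivAt (fun t : ℝ => a + t • (b - a)) (b - a) 0 := by
    simpa using ((hasDerivAt_id (0 : ℝ)).smul_const (b - a)).const_add a
  have hfd : HasFDerivAt f (InnerProductSpace.toDual ℝ E v) (a + (0 : ℝ) • (b - a)) := by
    simpa using hf.hasFDerivAt
  have hd : HasDerivAt (fun t : ℝ => f (a + t • (b - a))) ⟪v, b - a⟫ 0 := by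
    simpa [Function.comp_def] using hfd.comp_hasDerivAt (0 : ℝ) hline
  refine le_of_tendsto hd.tendsto_slope_zero_right ?_
  filter_upwards [Ioo_mem_nhdsGT (zero_lt_one' ℝ)] with t ht
  have := h t ht.1 ht.2
  simp only [zero_add, zero_smul, add_zero, smul_eq_mul]
  rwa [inv_mul_le_iff₀ ht.1]

theorem ConvexOn.inner_gradient_le_sub {f : E → ℝ} {v a : E} (hf : ConvexOn ℝ Set.univ f)
    (hv : HasGradientAt f v a) (b : E) : ⟪v, b - a⟫ ≤ f b - f a := by
  refine hv.inner_le_of_segment_le fun t ht0 ht1 => ?_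
  have h := hf.2 (Set.mem_univ a) (Set.mem_univ b) (sub_nonneg.2 ht1.le) ht0.le (by ring)
  have e : a + t • (b - a) = (1 - t) • a + t • b := by module
  rw [e]
  simp only [smul_eq_mul] at h
  linarith

/-- The gradient of a convex function is monotone. -/
theorem ConvexOn.inner_gradient_sub_nonneg {f : E → ℝ} {v w a b : E}
    (hf : ConvexOn ℝ Set.univ f) (hv : HasGradientAt f v a) (hw : HasGradientAt f w b) :
    0 ≤ ⟪v - w, a - b⟫ := by
  have h1 := hf.inner_gradient_le_sub hv b
  have h2 := hf.inner_gradient_le_sub hw a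
  rw [← neg_sub a b, inner_neg_right] at h1
  rw [inner_sub_left]
  linarith

/-- The variational inequality at a constrained maximizer. -/
theorem IsMaxOn.inner_gradient_nonpos {f : E → ℝ} {s : Set E} {v a b : E}
    (hmax : IsMaxOn f s a) (hs : Convex ℝ s) (hv : HasGradientAt f v a)
    (ha : a ∈ s) (hb : b ∈ s) : ⟪v, b - a⟫ ≤ 0 := by
  refine hv.inner_le_of_segment_le fun t ht0 ht1 => ?_
  have h : f (a + t • (b - a)) ≤ f a :=
    hmax (hs.add_smul_sub_mem ha hb ⟨ht0.le, ht1.le⟩)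
  linarith

theorem hasGradientAt_half_mul_norm_sub_sq (c : ℝ) (x₀ x : E) :
    HasGradientAt (fun u => c / 2 * ‖u - x₀‖ ^ 2) (c • (x - x₀)) x := by
  rw [hasGradientAt_iff_hasFDerivAt]
  have h := (((hasFDerivAt_id x).sub_const x₀).norm_sq).const_mul (c / 2)
  refine h.congr_fderiv ?_
  ext w
  simp
  ring

theorem HasGradientAt.sub_half_mul_norm_sub_sq {f : E → ℝ} {v x : E} (hf : HasGradientAt f v x)
    (c : ℝ) (x₀ : E) :
    HasGradientAt (fun u => f u - c / 2 * ‖u - x₀‖ ^ 2) (v - c • (x - x₀)) x := by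
  rw [hasGradientAt_iff_hasFDerivAt, map_sub]
  exact hf.hasFDerivAt.sub (hasGradientAt_half_mul_norm_sub_sq c x₀ x).hasFDerivAt

/-- The gradient of a strongly convex function is strongly monotone. -/
theorem StrongConvexOn.mul_norm_sub_sq_le_inner {f : E → ℝ} {v w a b : E} {c : ℝ}
    (hf : StrongConvexOn Set.univ c f) (hv : HasGradientAt f v a) (hw : HasGradientAt f w b) :
    c * ‖a - b‖ ^ 2 ≤ ⟪v - w, a - b⟫ := by
  have hconv : ConvexOn ℝ Set.univ (fun u => f u - c / 2 * ‖u - 0‖ ^ 2) := by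
    simpa using strongConvexOn_iff_convex.1 hf
  have h := hconv.inner_gradient_sub_nonneg (hv.sub_half_mul_norm_sub_sq c 0)
    (hw.sub_half_mul_norm_sub_sq c 0)
  have e : v - c • (a - 0) - (w - c • (b - 0)) = (v - w) - c • (a - b) := by module
  rw [e, inner_sub_left, real_inner_smul_left, real_inner_self_eq_norm_sq] at h
  linarith

end GradientInequalities

/-- Lemma 5: the regularized best-response map `y*_μ` is Lipschitz with constant `L_{yμ}/μ`. -/
theorem ystar_mu_lipschitz {n m d : ℕ}
    (X : Set (En n)) (Y : Set (En d))
    (hXne : X.Nonempty) (hXconv : Convex ℝ X) (hXcomp : IsCompact X)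
    (hYne : Y.Nonempty) (hYconv : Convex ℝ Y) (hYcomp : IsCompact Y)
    -- Assumption 1 (part for `∇_yΦ`)
    (Φ : En n → En m → En d → ℝ)
    (gradyΦ : En n → En m → En d → En d)
    (hΦsmooth : ContDiff ℝ 1 (fun p : En n × En m × En d => Φ p.1 p.2.1 p.2.2))
    (hgrady : ∀ x θ y, HasGradientAt (fun y' => Φ x θ y') (gradyΦ x θ y) y)
    (hconc : ∀ x θ, ConcaveOn ℝ Set.univ (Φ x θ))
    (Lyx Lyθ Lyy : ℝ) (hLyx : 0 ≤ Lyx) (hLyθ : 0 ≤ Lyθ) (hLyy : 0 ≤ Lyy)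
    (hLipyΦ : ∀ x x' θ θ' y y',
      ‖gradyΦ x θ y - gradyΦ x' θ' y'‖ ≤ Lyx * ‖x - x'‖ + Lyθ * ‖θ - θ'‖ + Lyy * ‖y - y'‖)
    -- the lower-level objective `g`
    (g : En n → En m → ℝ) (gθ : En n → En m → En m)
    (μg Cgθx : ℝ) (hμg : 0 < μg) (hCgθx : 0 ≤ Cgθx)
    (hggrad : ∀ x ∈ X, ∀ θ, HasGradientAt (g x) (gθ x θ) θ)
    (hgsc : ∀ x ∈ X, StrongConvexOn Set.univ μg (g x))
    (hgθLipx : ∀ θ, ∀ x ∈ X, ∀ x' ∈ X, ‖gθ x θ - gθ x' θ‖ ≤ Cgθx * ‖x - x'‖)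
    -- `θ*(x)` is the minimizer of `g(x,·)`
    (θstar : En n → En m)
    (hθmin : ∀ x ∈ X, IsMinOn (g x) Set.univ (θstar x))
    (hθgrad : ∀ x ∈ X, gθ x (θstar x) = 0)
    -- `y*_μ(x)` is the maximizer over `Y` of `L(x,·) − (μ/2)‖· − y₀‖²`
    (μ : ℝ) (hμ : 0 < μ) (y₀ : En d) (hy₀ : y₀ ∈ Y)
    (ystar : En n → En d)
    (hystar_mem : ∀ x ∈ X, ystar x ∈ Y)
    (hystar_max : ∀ x ∈ X,
      IsMaxOn (fun u : En d => Φ x (θstar x) u - μ / 2 * ‖u - y₀‖ ^ 2) Y (ystar x))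
    (Lθ Lyμ : ℝ) (hLθ : Lθ = Cgθx / μg) (hLyμ : Lyμ = Lyx + Lθ * Lyθ) :
    ∀ x ∈ X, ∀ x' ∈ X, ‖ystar x - ystar x'‖ ≤ (Lyμ / μ) * ‖x - x'‖ := by
  intro x hx x' hx'
  have hθ : ‖θstar x - θstar x'‖ ≤ Lθ * ‖x - x'‖ := by
    have hmono := (hgsc x hx).mul_norm_sub_sq_le_inner (hggrad x hx (θstar x))
      (hggrad x hx (θstar x'))
    rw [hθgrad x hx, ← hθgrad x' hx'] at hmono
    have h := norm_le_div_of_mul_norm_sq_le_inner hμg hmono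
      ((norm_sub_rev _ _).le.trans (hgθLipx (θstar x') x hx x' hx'))
    rwa [hLθ, div_mul_eq_mul_div]
  have hvar := (hystar_max x hx).inner_gradient_nonpos hYconv
    ((hgrady x (θstar x) (ystar x)).sub_half_mul_norm_sub_sq μ y₀)
    (hystar_mem x hx) (hystar_mem x' hx')
  have hvar' := (hystar_max x' hx').inner_gradient_nonpos hYconv
    ((hgrady x' (θstar x') (ystar x')).sub_half_mul_norm_sub_sq μ y₀)
    (hystar_mem x' hx') (hystar_mem x hx)
  have hneg : ∀ y, HasGradientAt (-Φ x' (θstar x')) (-gradyΦ x' (θstar x') y) y := fun y => by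
    rw [hasGradientAt_iff_hasFDerivAt, map_neg]
    exact (hgrady x' (θstar x') y).hasFDerivAt.neg
  have hmono := (hconc x' (θstar x')).neg.inner_gradient_sub_nonneg (hneg (ystar x))
    (hneg (ystar x'))
  have hkey : μ * ‖ystar x - ystar x'‖ ^ 2 ≤
      ⟪gradyΦ x (θstar x) (ystar x) - gradyΦ x' (θstar x') (ystar x), ystar x - ystar x'⟫ := by
    rw [← real_inner_self_eq_norm_sq]
    simp only [inner_sub_left, inner_sub_right, inner_neg_left, real_inner_smul_left]
      at hvar hvar' hmono ⊢
    linarith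
  have hgrad := hLipyΦ x x' (θstar x) (θstar x') (ystar x) (ystar x)
  rw [sub_self, norm_zero, mul_zero, add_zero] at hgrad
  have h := norm_le_div_of_mul_norm_sq_le_inner hμ hkey (K := Lyμ * ‖x - x'‖) (by
    have := mul_le_mul_of_nonneg_left hθ hLyθ
    rw [hLyμ]
    linarith)
  rwa [div_mul_eq_mul_div]
end

section
/- Let μ > 0, y_0 ∈ Y, σ = 2/(L^Φ_{yy} + 2μ), and ρ_D := L^Φ_{yy}/(L^Φ_{yy} + 2μ). Fix x ∈ X, θ ∈ R^m, y ∈ Y, and set y⁺ := P_Y( y + σ(∇_yΦ(x,θ,y) − μ(y − y_0)) ). Then ‖y⁺ − y*_μ(x)‖ ≤ ρ_D ‖y − y*_μ(x)‖ + σ L^Φ_{yθ} ‖θ − θ*(x)‖. -/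
open scoped RealInnerProductSpace

section FirstOrder

variable {E : Type*} [NormedAddCommGroup E] [InnerProductSpace ℝ E] [CompleteSpace E]

theorem HasGradientAt.hasDerivAt_line {f : E → ℝ} {f' x v : E} {t : ℝ}
    (hf : HasGradientAt f f' (x + t • v)) :
    HasDerivAt (fun s : ℝ => f (x + s • v)) ⟪f', v⟫ t := by
  have hline : HasDerivAt (fun s : ℝ => x + s • v) v t := by
    simpa using ((hasDerivAt_id t).smul_const v).const_add x
  simpa [Function.comp_def] using hf.hasFDerivAt.comp_hasDerivAt t hline

theorem ConcaveOn.le_add_inner_of_hasGradientAt {f : E → ℝ} {f' x : E}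
    (hf : ConcaveOn ℝ Set.univ f) (hx : HasGradientAt f f' x) (z : E) :
    f z ≤ f x + ⟪f', z - x⟫ := by
  have hconc : ConcaveOn ℝ Set.univ (fun t : ℝ => f (x + t • (z - x))) := by
    refine ⟨convex_univ, fun s _ t _ a b ha hb hab => ?_⟩
    have key := hf.2 (Set.mem_univ (x + s • (z - x))) (Set.mem_univ (x + t • (z - x))) ha hb hab
    convert key using 2
    obtain rfl : b = 1 - a := by linarith
    simp only [smul_eq_mul]
    module
  have hd : HasDerivAt (fun t : ℝ => f (x + t • (z - x))) ⟪f', z - x⟫ 0 :=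
    HasGradientAt.hasDerivAt_line (by simpa using hx)
  have := hconc.slope_le_of_hasDerivAt (Set.mem_univ 0) (Set.mem_univ 1) one_pos hd
  simp [slope_def_field] at this
  linarith

/-- The descent lemma, as a quadratic lower bound. -/
theorem add_inner_sub_le_of_lipschitz_gradient {f : E → ℝ} {f' : E → E} {L : ℝ}
    (hf : ∀ x, HasGradientAt f (f' x) x) (hL : ∀ x y, ‖f' x - f' y‖ ≤ L * ‖x - y‖) (x z : E) :
    f x + ⟪f' x, z - x⟫ - L / 2 * ‖z - x‖ ^ 2 ≤ f z := by
  set v := z - x with hv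
  have hd (t : ℝ) : HasDerivAt
      (fun s : ℝ => f (x + s • v) - s * ⟪f' x, v⟫ + L / 2 * ‖v‖ ^ 2 * s ^ 2)
      (⟪f' (x + t • v), v⟫ - ⟪f' x, v⟫ + L * ‖v‖ ^ 2 * t) t := by
    refine (((hf (x + t • v)).hasDerivAt_line.sub ((hasDerivAt_id t).mul_const ⟪f' x, v⟫)).add
      ((hasDerivAt_pow 2 t).const_mul (L / 2 * ‖v‖ ^ 2))).congr_deriv ?_
    norm_num
    ring
  have hmono := monotoneOn_of_deriv_nonneg (convex_Icc (0 : ℝ) 1)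
    (fun t _ => (hd t).continuousAt.continuousWithinAt)
    (fun t _ => (hd t).differentiableAt.differentiableWithinAt) (fun t ht => by
      rw [interior_Icc] at ht
      rw [(hd t).deriv, ← inner_sub_left]
      have hlip : ‖f' (x + t • v) - f' x‖ ≤ L * (t * ‖v‖) := by
        simpa [norm_smul, abs_of_pos ht.1] using hL (x + t • v) x
      have := neg_le_of_abs_le (abs_real_inner_le_norm (f' (x + t • v) - f' x) v)
      have := mul_le_mul_of_nonneg_right hlip (norm_nonneg v)
      linarith)
  have := hmono (Set.left_mem_Icc.2 zero_le_one) (Set.right_mem_Icc.2 zero_le_one) zero_le_one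
  simp [hv] at this
  simp only [hv]
  linarith

/-- The Baillon–Haddad inequality for concave functions. -/
theorem ConcaveOn.norm_gradient_sub_sq_le {f : E → ℝ} {f' : E → E} {L : ℝ} (hL₀ : 0 ≤ L)
    (hconc : ConcaveOn ℝ Set.univ f) (hf : ∀ x, HasGradientAt f (f' x) x)
    (hL : ∀ x y, ‖f' x - f' y‖ ≤ L * ‖x - y‖) (x y : E) :
    ‖f' x - f' y‖ ^ 2 ≤ -(L * ⟪f' x - f' y, x - y⟫) := by
  rcases hL₀.eq_or_lt with rfl | hpos
  · have : ‖f' x - f' y‖ = 0 := le_antisymm (by simpa using hL x y) (norm_nonneg _)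
    simp [this]
  have half (x y : E) : f x - f y + ‖f' x - f' y‖ ^ 2 / (2 * L) ≤ ⟪f' y, x - y⟫ := by
    have hlow := add_inner_sub_le_of_lipschitz_gradient hf hL x (x + L⁻¹ • (f' x - f' y))
    have hup := hconc.le_add_inner_of_hasGradientAt (hf y) (x + L⁻¹ • (f' x - f' y))
    have hsplit : x + L⁻¹ • (f' x - f' y) - y = (x - y) + L⁻¹ • (f' x - f' y) := by abel
    rw [hsplit, inner_add_right, real_inner_smul_right] at hup
    rw [add_sub_cancel_left, real_inner_smul_right, norm_smul, Real.norm_eq_abs, mul_pow,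
      sq_abs] at hlow
    have hsq : L⁻¹ * ⟪f' x, f' x - f' y⟫ - L⁻¹ * ⟪f' y, f' x - f' y⟫
        = L⁻¹ * ‖f' x - f' y‖ ^ 2 := by
      rw [← mul_sub, ← inner_sub_left, real_inner_self_eq_norm_sq]
    have hcoef : L / 2 * (L⁻¹ ^ 2 * ‖f' x - f' y‖ ^ 2) = ‖f' x - f' y‖ ^ 2 / (2 * L) := by
      field_simp
    have hcoef' : L⁻¹ * ‖f' x - f' y‖ ^ 2 = 2 * (‖f' x - f' y‖ ^ 2 / (2 * L)) := by
      field_simp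
    linarith
  have hxy := half x y
  have hyx := half y x
  rw [norm_sub_rev, ← neg_sub x y, inner_neg_right] at hyx
  have hsum : ‖f' x - f' y‖ ^ 2 / L ≤ -⟪f' x - f' y, x - y⟫ := by
    have : ‖f' x - f' y‖ ^ 2 / L = 2 * (‖f' x - f' y‖ ^ 2 / (2 * L)) := by field_simp
    rw [inner_sub_left]
    linarith
  rw [div_le_iff₀ hpos] at hsum
  linarith

theorem IsMaxOn.inner_gradient_sub_nonpos {f : E → ℝ} {f' x u : E} {s : Set E}
    (hmax : IsMaxOn f s x) (hf : HasGradientAt f f' x) (hs : Convex ℝ s) (hx : x ∈ s)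
    (hu : u ∈ s) : ⟪f', u - x⟫ ≤ 0 := by
  simpa using hmax.localize.hasFDerivWithinAt_nonpos hf.hasFDerivAt.hasFDerivWithinAt
    (sub_mem_posTangentConeAt_of_segment_subset (hs.segment_subset hx hu))

theorem HasFDerivAt.hasGradientAt_of_apply_eq_inner {f : E → ℝ} {φ : E →L[ℝ] ℝ} {f' x : E}
    (hf : HasFDerivAt f φ x) (hφ : ∀ v, φ v = ⟪f', v⟫) : HasGradientAt f f' x := by
  have : φ = InnerProductSpace.toDual ℝ E f' := by
    ext v
    simp [hφ]
  exact hasGradientAt_iff_hasFDerivAt.2 (this ▸ hf)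

theorem hasGradientAt_norm_sub_sq (c x : E) :
    HasGradientAt (fun u => ‖u - c‖ ^ 2) ((2 : ℝ) • (x - c)) x :=
  (((hasFDerivAt_id x).sub_const c).norm_sq).hasGradientAt_of_apply_eq_inner fun v => by
    simp [real_inner_smul_left, inner_sub_left]

/-- If `p` is nearest to `z` in `s` and `q ∈ s` satisfies the variational inequality
`⟪F, p - q⟫ ≤ 0`, then `p` is at least as close to `q` as `z` is to `q + σ • F`. -/
theorem norm_nearest_sub_le {s : Set E} {z p q F : E} {σ : ℝ} (hs : Convex ℝ s) (hσ : 0 ≤ σ)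
    (hp : p ∈ s) (hmin : ∀ u ∈ s, ‖z - p‖ ≤ ‖z - u‖) (hq : q ∈ s) (hF : ⟪F, p - q⟫ ≤ 0) :
    ‖p - q‖ ≤ ‖z - (q + σ • F)‖ := by
  have hmax : IsMaxOn (fun u => -‖u - z‖ ^ 2) s p := fun u hu => by
    have := hmin u hu
    rw [norm_sub_rev z p, norm_sub_rev z u] at this
    simp only [Set.mem_ofPred_eq]
    gcongr
  have hgrad : HasGradientAt (fun u => -‖u - z‖ ^ 2) (-((2 : ℝ) • (p - z))) p :=
    (hasGradientAt_norm_sub_sq z p).hasFDerivAt.neg.hasGradientAt_of_apply_eq_inner fun v => by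
      simp [real_inner_smul_left, inner_sub_left]
  have hproj := hmax.inner_gradient_sub_nonpos hgrad hs hp hq
  rw [inner_neg_left, real_inner_smul_left] at hproj
  have hsq : ‖p - q‖ ^ 2 ≤ ⟪z - (q + σ • F), p - q⟫ := by
    have hexp : ⟪z - (q + σ • F), p - q⟫
        = ‖p - q‖ ^ 2 + ⟪p - z, q - p⟫ - σ * ⟪F, p - q⟫ := by
      rw [← neg_sub p q, inner_neg_right, ← real_inner_self_eq_norm_sq (p - q),
        ← real_inner_smul_left, ← sub_eq_add_neg, ← inner_sub_left, ← inner_sub_left]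
      congr 1
      abel
    nlinarith [mul_nonneg hσ (neg_nonneg.2 hF)]
  have hcs := real_inner_le_norm (z - (q + σ • F)) (p - q)
  by_contra! hlt
  nlinarith [norm_nonneg (p - q), norm_nonneg (z - (q + σ • F))]

theorem ConcaveOn.norm_smul_add_gradient_sub_le {f : E → ℝ} {f' : E → E} {L : ℝ} (hL₀ : 0 ≤ L)
    (hconc : ConcaveOn ℝ Set.univ f) (hf : ∀ x, HasGradientAt f (f' x) x)
    (hL : ∀ x y, ‖f' x - f' y‖ ≤ L * ‖x - y‖) (x y : E) :
    ‖L • (x - y) + (2 : ℝ) • (f' x - f' y)‖ ≤ L * ‖x - y‖ := by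
  have hco := hconc.norm_gradient_sub_sq_le hL₀ hf hL x y
  refine abs_le_of_sq_le_sq' ?_ (by positivity) |>.2
  rw [norm_add_sq_real, norm_smul, norm_smul, real_inner_smul_left, real_inner_smul_right,
    real_inner_comm, Real.norm_of_nonneg hL₀, Real.norm_of_nonneg zero_le_two]
  linarith

end FirstOrder

/-- Lemma 7 (one-step version): contraction of the projected dual ascent step toward
`y*_μ(x)`. -/
theorem dual_step_contraction {n m d : ℕ}
    (X : Set (En n)) (Y : Set (En d))
    (hXne : X.Nonempty) (hXconv : Convex ℝ X) (hXcomp : IsCompact X)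
    (hYne : Y.Nonempty) (hYconv : Convex ℝ Y) (hYcomp : IsCompact Y)
    -- Assumption 1 (part for `∇_yΦ`)
    (Φ : En n → En m → En d → ℝ)
    (gradyΦ : En n → En m → En d → En d)
    (hΦsmooth : ContDiff ℝ 1 (fun p : En n × En m × En d => Φ p.1 p.2.1 p.2.2))
    (hgrady : ∀ x θ y, HasGradientAt (fun y' => Φ x θ y') (gradyΦ x θ y) y)
    (hconc : ∀ x θ, ConcaveOn ℝ Set.univ (Φ x θ))
    (Lyx Lyθ Lyy : ℝ) (hLyx : 0 ≤ Lyx) (hLyθ : 0 ≤ Lyθ) (hLyy : 0 ≤ Lyy)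
    (hLipyΦ : ∀ x x' θ θ' y y',
      ‖gradyΦ x θ y - gradyΦ x' θ' y'‖ ≤ Lyx * ‖x - x'‖ + Lyθ * ‖θ - θ'‖ + Lyy * ‖y - y'‖)
    -- the lower-level objective `g`
    (g : En n → En m → ℝ) (gθ : En n → En m → En m)
    (μg : ℝ) (hμg : 0 < μg)
    (hggrad : ∀ x ∈ X, ∀ θ, HasGradientAt (g x) (gθ x θ) θ)
    (hgsc : ∀ x ∈ X, StrongConvexOn Set.univ μg (g x))
    (θstar : En n → En m)
    (hθmin : ∀ x ∈ X, IsMinOn (g x) Set.univ (θstar x))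
    (hθgrad : ∀ x ∈ X, gθ x (θstar x) = 0)
    -- the nearest-point projection onto `Y`
    (PY : En d → En d)
    (hPY : ∀ z, PY z ∈ Y ∧ ∀ u ∈ Y, ‖z - PY z‖ ≤ ‖z - u‖)
    -- regularization and step size
    (μ σ ρD : ℝ) (hμ : 0 < μ)
    (hσ : σ = 2 / (Lyy + 2 * μ)) (hρD : ρD = Lyy / (Lyy + 2 * μ))
    (y₀ : En d) (hy₀ : y₀ ∈ Y)
    -- `y*_μ(x)` is the maximizer over `Y` of `L(x,·) − (μ/2)‖· − y₀‖²`
    (ystar : En n → En d)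
    (hystar_mem : ∀ x ∈ X, ystar x ∈ Y)
    (hystar_max : ∀ x ∈ X,
      IsMaxOn (fun u : En d => Φ x (θstar x) u - μ / 2 * ‖u - y₀‖ ^ 2) Y (ystar x)) :
    ∀ x ∈ X, ∀ θ : En m, ∀ y ∈ Y,
      ‖PY (y + σ • (gradyΦ x θ y - μ • (y - y₀))) - ystar x‖ ≤
        ρD * ‖y - ystar x‖ + σ * Lyθ * ‖θ - θstar x‖ := by
  intro x hx θ y hy
  have hpos : 0 < Lyy + 2 * μ := by positivity
  have hσ₀ : 0 ≤ σ := hσ ▸ by positivity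
  set q := ystar x
  set G := gradyΦ x (θstar x)
  have hgradq : HasGradientAt (fun u : En d => Φ x (θstar x) u - μ / 2 * ‖u - y₀‖ ^ 2)
      (G q - μ • (q - y₀)) q :=
    ((hgrady x (θstar x) q).hasFDerivAt.sub ((hasGradientAt_norm_sub_sq y₀
      q).hasFDerivAt.const_mul (μ / 2))).hasGradientAt_of_apply_eq_inner fun v => by
        simp [real_inner_smul_left, inner_sub_left, G]
        ring
  have hvi := (hystar_max x hx).inner_gradient_sub_nonpos hgradq hYconv (hystar_mem x hx)
    (hPY (y + σ • (gradyΦ x θ y - μ • (y - y₀)))).1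
  have hstep := norm_nearest_sub_le hYconv hσ₀ (hPY _).1 (hPY _).2 (hystar_mem x hx) hvi
  refine hstep.trans ?_
  have hsplit : y + σ • (gradyΦ x θ y - μ • (y - y₀)) - (q + σ • (G q - μ • (q - y₀)))
      = (Lyy + 2 * μ)⁻¹ • (Lyy • (y - q) + (2 : ℝ) • (G y - G q))
        + σ • (gradyΦ x θ y - G y) := by
    have hone : (Lyy + 2 * μ)⁻¹ * Lyy = 1 - σ * μ := by
      rw [hσ]
      field_simp
      ring
    have htwo : (Lyy + 2 * μ)⁻¹ * 2 = σ := by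
      rw [hσ]
      ring
    rw [smul_add, smul_smul, smul_smul, hone, htwo]
    module
  have hcontr := (hconc x (θstar x)).norm_smul_add_gradient_sub_le hLyy (hgrady x (θstar x))
    (fun u w => by simpa using hLipyΦ x x (θstar x) (θstar x) u w) y q
  have hpert : ‖gradyΦ x θ y - G y‖ ≤ Lyθ * ‖θ - θstar x‖ := by
    simpa using hLipyΦ x x θ (θstar x) y y
  rw [hsplit]
  refine (norm_add_le _ _).trans (add_le_add ?_ ?_)
  · rw [norm_smul, Real.norm_of_nonneg (inv_nonneg.2 hpos.le), hρD, div_eq_inv_mul, mul_assoc]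
    gcongr
  · rw [norm_smul, Real.norm_of_nonneg hσ₀, mul_assoc]
    gcongr
end
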